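/- Let A be the localization of ℂ[x_{ij} : 1 ≤ i,j ≤ 3] at x₁₃, and let {·,·} : A × A → A be ℂ-bilinear, a derivation in each argument, and satisfy on generators {x_{ij}, x_{km}} = x_{im}x_{kj}(ε_{ik} + ε_{mj}) + 2δ_{im} Σ_{l>i} x_{kl}x_{lj} − 2δ_{jk} Σ_{l>j} x_{il}x_{lm} + x_{ij}x_{km}(δ_{im} − δ_{jk}), where ε_{ab} = sign(a−b). Define φ̄_α = x₁₃²(x₁₁x₂₃ − x₁₃x₂₁) + x₂₃, φ̄_β = x₃₂ − x₁₂x₁₃⁻³(1 + x₁₃²x₃₃), φ̄_t = x₁₃, and set X = φ̄_t² φ̄_α, Y = φ̄_t² φ̄_β, W = φ̄_t² + 1. Let t ∈ ℂ*, α, β, γ ∈ ℂ satisfy γ = 3 + t⁻² and 2t² + t⁻⁴ + 2αβ + γ² = 3, let S = S(t,α,β,γ) = [[0,0,t],[0,−t⁻²,α],[t,β,γ]], and set x = t²α, y = t²β, z = t²+1. Then, evaluating at S: {X, Y}(S) = 6(z−1)z², {W, X}(S) = 2(z−1)x, and {W, Y}(S) = −2(z−1)y. -/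

import Mathlib

open MvPolynomial Matrix

/-- The polynomial ring `ℂ[x_{ij} : 1 ≤ i,j ≤ 3]`. -/
noncomputable abbrev PRing : Type := MvPolynomial (Fin 3 × Fin 3) ℂ

/-- The localization `A` of `ℂ[x_{ij}]` at the element `x₁₃`. -/
noncomputable abbrev ARing : Type := Localization.Away (X ((0 : Fin 3), (2 : Fin 3)) : PRing)

/-- The generator `x_{ij}` viewed in the localization `A`. -/
noncomputable def xv (i j : Fin 3) : ARing := algebraMap PRing ARing (X (i, j))

/-- `ε_{ab} = sign(a − b)`. -/
noncomputable def eps (a b : Fin 3) : ℂ := if b < a then 1 else if a = b then 0 else -1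

/-- The Kronecker delta `δ_{ab}`. -/
noncomputable def kdelta (a b : Fin 3) : ℂ := if a = b then 1 else 0

/-- The slice element `S(t,α,β,γ)`. -/
noncomputable def Smat (t α β γ : ℂ) : Matrix (Fin 3) (Fin 3) ℂ :=
  !![0, 0, t; 0, -(t ^ 2)⁻¹, α; t, β, γ]

/-- `φ̄_α = x₁₃²(x₁₁x₂₃ − x₁₃x₂₁) + x₂₃`. -/
noncomputable def phiA : ARing :=
  xv 0 2 ^ 2 * (xv 0 0 * xv 1 2 - xv 0 2 * xv 1 0) + xv 1 2

/-- `φ̄_β = x₃₂ − x₁₂ x₁₃⁻³ (1 + x₁₃² x₃₃)`, where `u = x₁₃⁻¹`. -/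
noncomputable def phiB (u : ARing) : ARing :=
  xv 2 1 - xv 0 1 * u ^ 3 * (1 + xv 0 2 ^ 2 * xv 2 2)

/-- `φ̄_γ = x₁₁ + x₂₂ + x₃₃ + x₁₃⁻²`, where `u = x₁₃⁻¹`. -/
noncomputable def phiG (u : ARing) : ARing :=
  xv 0 0 + xv 1 1 + xv 2 2 + u ^ 2

/-- `φ̄_t = x₁₃`. -/
noncomputable def phiT : ARing := xv 0 2

section PointDerivation

variable {ev : ARing →+* ℂ} {D : ARing → ℂ}

theorem pointDerivation_one (hmul : ∀ a b, D (a * b) = ev a * D b + D a * ev b) : D 1 = 0 := by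
  simpa using hmul 1 1

theorem pointDerivation_sub (hadd : ∀ a b, D (a + b) = D a + D b) (a b : ARing) :
    D (a - b) = D a - D b := by
  have h := hadd (a - b) b
  rw [sub_add_cancel] at h
  rw [h, add_sub_cancel_right]

theorem pointDerivation_sq (hmul : ∀ a b, D (a * b) = ev a * D b + D a * ev b) (a : ARing) :
    D (a ^ 2) = 2 * ev a * D a := by
  rw [pow_two, hmul]; ring

variable {t α β γ : ℂ}

theorem pointDerivation_phiT_sq_add_one (hadd : ∀ a b, D (a + b) = D a + D b)
    (hmul : ∀ a b, D (a * b) = ev a * D b + D a * ev b)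
    (hev : ∀ i j : Fin 3, ev (xv i j) = Smat t α β γ i j) :
    D (phiT ^ 2 + 1) = 2 * t * D (xv 0 2) := by
  rw [hadd, pointDerivation_one hmul, pointDerivation_sq hmul, phiT, hev]
  simp [Smat]

theorem pointDerivation_phiT_sq_mul_phiA (hadd : ∀ a b, D (a + b) = D a + D b)
    (hmul : ∀ a b, D (a * b) = ev a * D b + D a * ev b)
    (hev : ∀ i j : Fin 3, ev (xv i j) = Smat t α β γ i j) :
    D (phiT ^ 2 * phiA) = 2 * t * α * D (xv 0 2) +
      t ^ 2 * (t ^ 2 * α * D (xv 0 0) - t ^ 3 * D (xv 1 0) + D (xv 1 2)) := by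
  simp only [phiT, phiA, hadd, hmul, pointDerivation_sub hadd, pointDerivation_sq hmul, map_add,
    map_sub, map_mul, map_pow, hev]
  simp [Smat]
  ring

theorem pointDerivation_phiT_sq_mul_phiB (hadd : ∀ a b, D (a + b) = D a + D b)
    (hmul : ∀ a b, D (a * b) = ev a * D b + D a * ev b)
    (hev : ∀ i j : Fin 3, ev (xv i j) = Smat t α β γ i j) (ht : t ≠ 0)
    {u : ARing} (hu : u * xv 0 2 = 1) :
    D (phiT ^ 2 * phiB u) = 2 * t * β * D (xv 0 2) +
      t ^ 2 * (D (xv 2 1) - (1 + t ^ 2 * γ) * (t ^ 3)⁻¹ * D (xv 0 1)) := by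
  have hut : ev u = t⁻¹ := by
    have h := congrArg ev hu
    rw [map_mul, hev, map_one] at h
    exact eq_inv_of_mul_eq_one_left (by simpa [Smat] using h)
  simp only [phiT, phiB, hadd, hmul, pointDerivation_sub hadd, pointDerivation_sq hmul, map_add,
    map_sub, map_mul, map_pow, map_one, hev, hut]
  simp [Smat]
  field_simp
  ring

end PointDerivation

/-- With the bracket of formula (4.7) on the localization `A` of
`ℂ[x_{ij}]` at `x₁₃`, set `X = φ̄_t² φ̄_α`, `Y = φ̄_t² φ̄_β`, `W = φ̄_t² + 1`.  If the slice
point `S(t,α,β,γ)` lies in the singular fiber (`γ = 3 + t⁻²` and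
`2t² + t⁻⁴ + 2αβ + γ² = 3`), then with `x = t²α`, `y = t²β`, `z = t² + 1`, evaluation at
`S` gives `{X,Y} = 6(z−1)z²`, `{W,X} = 2(z−1)x`, `{W,Y} = −2(z−1)y` (formula (4.13)). -/
theorem stmt_13 (B : ARing → ARing → ARing)
    (hadd_l : ∀ a b c : ARing, B (a + b) c = B a c + B b c)
    (hadd_r : ∀ a b c : ARing, B a (b + c) = B a b + B a c)
    (hsmul_l : ∀ (r : ℂ) (a b : ARing), B (r • a) b = r • B a b)
    (hsmul_r : ∀ (r : ℂ) (a b : ARing), B a (r • b) = r • B a b)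
    (hder_l : ∀ a b c : ARing, B (a * b) c = a * B b c + B a c * b)
    (hder_r : ∀ a b c : ARing, B a (b * c) = B a b * c + b * B a c)
    (hgen : ∀ i j k m : Fin 3,
      B (xv i j) (xv k m) =
        algebraMap PRing ARing (C (eps i k + eps m j)) * (xv i m * xv k j)
          + algebraMap PRing ARing (C (2 * kdelta i m)) *
            (∑ l ∈ Finset.univ.filter (fun l => i < l), xv k l * xv l j)
          - algebraMap PRing ARing (C (2 * kdelta j k)) *
            (∑ l ∈ Finset.univ.filter (fun l => j < l), xv i l * xv l m)
          + algebraMap PRing ARing (C (kdelta i m - kdelta j k)) * (xv i j * xv k m))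
    (u : ARing) (hu : u * xv 0 2 = 1)
    (t α β γ : ℂ) (ht : t ≠ 0)
    (hγ : γ = 3 + (t ^ 2)⁻¹)
    (hfib : 2 * t ^ 2 + (t ^ 4)⁻¹ + 2 * α * β + γ ^ 2 = 3)
    (ev : ARing →+* ℂ)
    (hevC : ∀ c : ℂ, ev (algebraMap PRing ARing (C c)) = c)
    (hev : ∀ i j : Fin 3, ev (xv i j) = Smat t α β γ i j) :
    ev (B (phiT ^ 2 * phiA) (phiT ^ 2 * phiB u)) =
        6 * ((t ^ 2 + 1) - 1) * (t ^ 2 + 1) ^ 2 ∧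
    ev (B (phiT ^ 2 + 1) (phiT ^ 2 * phiA)) = 2 * ((t ^ 2 + 1) - 1) * (t ^ 2 * α) ∧
    ev (B (phiT ^ 2 + 1) (phiT ^ 2 * phiB u)) = -(2 * ((t ^ 2 + 1) - 1) * (t ^ 2 * β)) := by
  have hl_add : ∀ c a b, ev (B (a + b) c) = ev (B a c) + ev (B b c) := fun c a b => by
    rw [hadd_l, map_add]
  have hl_mul : ∀ c a b, ev (B (a * b) c) = ev a * ev (B b c) + ev (B a c) * ev b :=
    fun c a b => by rw [hder_l, map_add, map_mul, map_mul]
  have hr_add : ∀ c a b, ev (B c (a + b)) = ev (B c a) + ev (B c b) := fun c a b => by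
    rw [hadd_r, map_add]
  have hr_mul : ∀ c a b, ev (B c (a * b)) = ev a * ev (B c b) + ev (B c a) * ev b :=
    fun c a b => by rw [hder_r, map_add, map_mul, map_mul, add_comm]
  have hW := fun c => pointDerivation_phiT_sq_add_one (D := fun a => ev (B a c))
    (hl_add c) (hl_mul c) hev
  have hXl := fun c => pointDerivation_phiT_sq_mul_phiA (D := fun a => ev (B a c))
    (hl_add c) (hl_mul c) hev
  have hXr := fun c => pointDerivation_phiT_sq_mul_phiA (D := fun a => ev (B c a))
    (hr_add c) (hr_mul c) hev
  have hYr := fun c => pointDerivation_phiT_sq_mul_phiB (D := fun a => ev (B c a))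
    (hr_add c) (hr_mul c) hev ht hu
  have hS := fun i j k m => congrArg ev (hgen i j k m)
  simp only [map_add, map_sub, map_mul, apply_ite ev, map_zero, hevC, hev, Finset.sum_filter,
    Fin.sum_univ_three] at hS
  simp only [hW, hXl, hXr, hYr, hS]
  simp [Smat, eps, kdelta]
  subst hγ
  field_simp at hfib ⊢
  exact ⟨by linear_combination (-2) * hfib, by ring, trivial⟩
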